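/- arXiv:1609.08204 — 2 statements merged into one kernel-verified Lean document; each statement's English description precedes it below -/
import Mathlib

section
/- Let μ be a Borel probability measure on ℝ. If the pushforward of μ under the fractional-part map x ↦ x − ⌊x⌋ equals the restriction of Lebesgue measure to [0,1), then μ is absolutely continuous with respect to Lebesgue measure on ℝ (and hence admits an a.e. finite density). In particular, every CIUPM for any measurable transformation T : ℝ → ℝ is absolutely continuous. -/
open MeasureTheory Set

/-- A probability measure `μ` on `ℝ` is a CIUPM for a map `T : ℝ → ℝ` if the pushforwards
of `μ` and of `μ ∘ T⁻¹` under the fractional-part map both equal Lebesgue measure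
restricted to `[0,1)`. -/
def IsCIUPM (T : ℝ → ℝ) (μ : Measure ℝ) : Prop :=
  μ.map Int.fract = volume.restrict (Ico (0 : ℝ) 1) ∧
    (μ.map T).map Int.fract = volume.restrict (Ico (0 : ℝ) 1)

/-- A measure on `ℝ` whose pushforward under the fractional-part map is absolutely continuous
with respect to Lebesgue measure is itself absolutely continuous. -/
theorem absolutelyContinuous_of_map_fract {μ : Measure ℝ}
    (h : μ.map Int.fract ≪ volume) : μ ≪ volume := by
  intro N hN
  have hnull : volume (⋃ n : ℤ, (fun x : ℝ => x + n) ⁻¹' N) = 0 :=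
    measure_iUnion_null fun n => by rw [measure_preimage_add_right, hN]
  refine measure_mono_null (t := Int.fract ⁻¹' ⋃ n : ℤ, (fun x : ℝ => x + n) ⁻¹' N)
    (fun x hx => mem_iUnion.2 ⟨⌊x⌋, ?_⟩) ?_
  · simpa [Int.fract_add_floor] using hx
  · exact Measure.preimage_null_of_map_null measurable_fract.aemeasurable (h hnull)

theorem stmt_0 (μ : Measure ℝ) [IsProbabilityMeasure μ]
    (h : μ.map Int.fract = volume.restrict (Ico (0 : ℝ) 1)) :
    μ ≪ volume ∧
      ∀ (T : ℝ → ℝ), Measurable T → ∀ ν : Measure ℝ, IsProbabilityMeasure ν →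
        IsCIUPM T ν → ν ≪ volume := by
  exact ⟨absolutelyContinuous_of_map_fract (h ▸ Measure.absolutelyContinuous_of_le
      Measure.restrict_le_self),
    fun T _ ν _ hν => absolutelyContinuous_of_map_fract (hν.1 ▸
      Measure.absolutelyContinuous_of_le Measure.restrict_le_self)⟩
end

section
/- Let μ be a Borel probability measure on ℝ such that the pushforward of μ under the fractional-part map x ↦ x − ⌊x⌋ equals the restriction of Lebesgue measure to [0,1). Then the diameter of the support of μ is at least 1. In particular, every CIUPM for any measurable transformation T has support of diameter at least 1. -/
open MeasureTheory Set

/-- The topological support of a measure on `ℝ`: the set of points all of whose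
neighbourhoods have positive measure (the smallest closed set of full measure). -/
def msupp (μ : Measure ℝ) : Set ℝ := {x : ℝ | ∀ U ∈ nhds x, 0 < μ U}

/-- A measure on `ℝ` with Lebesgue fractional part has support of diameter at least `1`: otherwise
an interval of fractional parts of positive length would be missed by the support. -/
theorem one_le_ediam_msupp {μ : Measure ℝ}
    (h : μ.map Int.fract = volume.restrict (Ico (0 : ℝ) 1)) :
    1 ≤ Metric.ediam (msupp μ) := by
  by_contra! hlt
  have hbdd : Bornology.IsBounded (msupp μ) :=
    Metric.isBounded_iff_ediam_ne_top.2 (hlt.trans ENNReal.one_lt_top).ne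
  have hab := hbdd.subset_Icc_sInf_sSup
  rw [Real.ediam_eq hbdd, ENNReal.ofReal_lt_one] at hlt
  set a := sInf (msupp μ)
  set b := sSup (msupp μ)
  let B : Set ℝ := Ioo (Int.fract b) (min 1 (a + 1 - ⌊b⌋))
  have hfb : Int.fract b = b - ⌊b⌋ := rfl
  have hB01 : B ⊆ Ico 0 1 := fun y hy =>
    ⟨(Int.fract_nonneg b).trans hy.1.le, hy.2.trans_le (min_le_left _ _)⟩
  have hpos : μ (Int.fract ⁻¹' B) ≠ 0 := by
    rw [← Measure.map_apply measurable_fract measurableSet_Ioo, h,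
      Measure.restrict_apply measurableSet_Ioo, inter_eq_left.2 hB01, Real.volume_Ioo]
    have : Int.fract b < min 1 (a + 1 - ⌊b⌋) := lt_min (Int.fract_lt_one b) (by linarith)
    exact (ENNReal.ofReal_pos.2 (sub_pos.2 this)).ne'
  obtain ⟨x, hxB, hx⟩ := exists_mem_forall_mem_nhdsWithin_pos_measure hpos
  have hxab := hab (show x ∈ msupp μ from fun U hU => hx U (mem_nhdsWithin_of_mem_nhds hU))
  have hfx : Int.fract x = x - ⌊x⌋ := rfl
  have h1 : Int.fract b < Int.fract x := hxB.1
  have h2 : Int.fract x < a + 1 - ⌊b⌋ := hxB.2.trans_le (min_le_right _ _)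
  have h3 : (⌊x⌋ : ℝ) < ⌊b⌋ := by linarith [hxab.2]
  have h4 : (⌊b⌋ : ℝ) < ⌊x⌋ + 1 := by linarith [hxab.1]
  norm_cast at h3 h4
  omega

theorem stmt_19 (μ : Measure ℝ) [IsProbabilityMeasure μ]
    (h : μ.map Int.fract = volume.restrict (Ico (0 : ℝ) 1)) :
    1 ≤ EMetric.diam (msupp μ) ∧
      ∀ (T : ℝ → ℝ), Measurable T → ∀ ν : Measure ℝ, IsProbabilityMeasure ν →
        IsCIUPM T ν → 1 ≤ EMetric.diam (msupp ν) := by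
  exact ⟨one_le_ediam_msupp h, fun _ _ _ _ hν => one_le_ediam_msupp hν.1⟩
end
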